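/- If X has the Laplace density f(x) = (1/(2β)) e^{−|x|/β} for x ∈ ℝ, β > 0, then the weighted varextropy VJ^w(X) equals 1/216, independently of β, while the (unweighted) varextropy VJ(X) equals 1/(192 β²). -/

import Mathlib

open MeasureTheory Real

lemma aux_int (n : ℕ) (r : ℝ) (hr : 0 < r) :
    ∫ t in Set.Ioi (0:ℝ), t^n * Real.exp (-(r*t)) = (1/r)^(n+1) * (n.factorial : ℝ) := by
  have h := Real.integral_rpow_mul_exp_neg_mul_Ioi (a := (n:ℝ)+1) (r := r) (by positivity) hr
  rw [Real.Gamma_nat_eq_factorial] at h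
  simp only [add_sub_cancel_right, Real.rpow_natCast] at h
  rw [h]
  congr 1
  exact_mod_cast Real.rpow_natCast (1/r) (n+1)

lemma aux_abs (n m : ℕ) (hm : 0 < m) (β : ℝ) (hβ : 0 < β) :
    ∫ x : ℝ, |x|^n * ((1/(2*β)) * Real.exp (-|x|/β))^m
      = 2 * ((1/(2*β))^m * ((β/m)^(n+1) * (n.factorial : ℝ))) := by
  rw [integral_comp_abs (f := fun x => x^n * ((1/(2*β)) * Real.exp (-x/β))^m)]
  have hm' : (0:ℝ) < m := by exact_mod_cast hm
  have h := aux_int n (m/β) (by positivity)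
  rw [one_div_div] at h
  rw [← h, ← integral_const_mul ((1/(2*β))^m)]
  congr 1
  refine integral_congr_ae (Filter.Eventually.of_forall ?_)
  intro x
  beta_reduce
  rw [mul_pow, ← Real.exp_nat_mul]
  have : (m:ℝ) * (-x/β) = -(m/β*x) := by ring
  rw [this]; ring

/-- For the Laplace density `f(x) = (1/(2β)) e^(−|x|/β)`, the weighted
varextropy equals `1/216` (independently of `β`), while the varextropy
equals `1/(192 β²)`. -/
theorem varextropy_laplace (β : ℝ) (hβ : 0 < β) :
    ((1/4 : ℝ) * (∫ x : ℝ, x^2 * ((1/(2*β)) * Real.exp (-|x|/β))^3)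
        - ((1/2 : ℝ) * ∫ x : ℝ, x * ((1/(2*β)) * Real.exp (-|x|/β))^2)^2
      = 1/216)
    ∧ ((1/4 : ℝ) * (∫ x : ℝ, ((1/(2*β)) * Real.exp (-|x|/β))^3)
        - ((1/2 : ℝ) * ∫ x : ℝ, ((1/(2*β)) * Real.exp (-|x|/β))^2)^2
      = 1/(192 * β^2)) := by
  have h1 := aux_abs 2 3 (by norm_num) β hβ
  have h2 := aux_abs 0 3 (by norm_num) β hβ
  have h3 := aux_abs 0 2 (by norm_num) β hβ
  have h4 : ∫ x : ℝ, x * ((1/(2*β)) * Real.exp (-|x|/β))^2 = 0 := by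
    have h := integral_neg_eq_self (fun x : ℝ => x * ((1/(2*β)) * Real.exp (-|x|/β))^2) volume
    simp only [abs_neg, neg_mul, integral_neg] at h
    linarith
  simp only [sq_abs] at h1
  simp only [pow_zero, one_mul] at h2 h3
  rw [h1, h2, h3, h4]
  constructor
  · simp [Nat.factorial]; field_simp; norm_num
  · simp [Nat.factorial]; field_simp; norm_num
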